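/- Let A be a complex C*-algebra and let Ã denote its unitization, with A regarded as a subalgebra of Ã. Suppose A almost has stable rank one, i.e., every element of A lies in the closure of the set of invertible elements of Ã. Then Ã has stable rank at most two: the set of left invertible pairs {(a,b) ∈ Ã × Ã : there exist c,d ∈ Ã with c·a + d·b = 1} is dense in Ã × Ã. -/

import Mathlib

/-- if a C*-algebra `A` almost has stable rank one (every element of `A` is a
limit of invertible elements of the unitization `Ã`), then `Ã` has stable rank at most two:
the left invertible pairs are dense in `Ã × Ã`. -/
theorem stable_rank_le_two_of_almost_stable_rank_one {A : Type*} [NonUnitalCStarAlgebra A]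
    (h : ∀ a : A, (a : Unitization ℂ A) ∈ closure {u : Unitization ℂ A | IsUnit u}) :
    Dense {p : Unitization ℂ A × Unitization ℂ A |
      ∃ c d : Unitization ℂ A, c * p.1 + d * p.2 = 1} := by
  rintro ⟨a, b⟩
  by_cases ha : a.fst = 0
  · have hmem : a ∈ closure {u : Unitization ℂ A | IsUnit u} := by
      have hsnd : (a.snd : Unitization ℂ A) = a := by ext <;> simp [ha]
      exact hsnd ▸ h a.snd
    refine map_mem_closure (f := fun u => (u, b)) (by fun_prop) hmem ?_
    rintro _ ⟨u, rfl⟩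
    exact ⟨↑u⁻¹, 0, by simp⟩
  · -- Subtracting a scalar multiple of `a` from `b` lands in `A`.
    set k : ℂ := b.fst / a.fst with hk
    have hmem : b - k • a ∈ closure {u : Unitization ℂ A | IsUnit u} := by
      have hsnd : ((b - k • a).snd : Unitization ℂ A) = b - k • a := by
        ext <;> simp [sub_eq_add_neg, hk, ha]
      exact hsnd ▸ h (b - k • a).snd
    have hab : (a, b) = (a, b - k • a + k • a) := by rw [sub_add_cancel]
    rw [hab]
    refine map_mem_closure (f := fun u => (a, u + k • a)) (by fun_prop) hmem ?_
    rintro _ ⟨u, rfl⟩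
    exact ⟨-(k • (↑u⁻¹ : Unitization ℂ A)), ↑u⁻¹, by simp [mul_add]⟩
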